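/- (Weak coassociativity for comodules.) Let M be a comodule over a graded vertex coalgebra (V, Y_V, c). For every v' ∈ (V ⊗ V ⊗ M)' there exists k ∈ ℤ_+ (depending only on v') such that for every w ∈ M, (x_0+x_2)^k ⟨v', (Y_V(x_0) ⊗ Id_M)Y_M(x_2)w − (Id_V ⊗ Y_M(x_2))Y_M(x_0 + x_2)w⟩ = 0 as a formal series in x_0, x_2, where Y_M(x_0 + x_2) is expanded in nonnegative integral powers of x_2. -/

import Mathlib

/- Common background for the formalization of "Vertex coalgebras, comodules,
cocommutativity and coassociativity" (K. Hubbard).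

A vertex coalgebra `(V, Y, c)` is encoded by the family of coefficient maps
`Δ k : V →ₗ V ⊗ V` of the coproduct `Y(x)v = ∑ₖ Δ k v · x^(-k-1)` together with
the covacuum `c : V →ₗ F`.  All identities of formal series are encoded
coefficient-wise; in particular the Jacobi identity is encoded by its
(dual Borcherds) coefficient form. -/

noncomputable section

open scoped TensorProduct

variable (F : Type) [Field F] [CharZero F]

/-- The generalized binomial coefficient `(a choose i)` as an element of `F`. -/
def gchoose (a : ℤ) (i : ℕ) : F :=
  (∏ j ∈ Finset.range i, ((a : F) - (j : F))) / (Nat.factorial i : F)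

variable {V M : Type} [AddCommGroup V] [Module F V] [AddCommGroup M] [Module F M]

/-- `c ⊗ Id` composed with the canonical identification `F ⊗ M ≃ M`. -/
def cLeft (c : V →ₗ[F] F) : V ⊗[F] M →ₗ[F] M :=
  (TensorProduct.lid F M).toLinearMap ∘ₗ TensorProduct.map c LinearMap.id

/-- `Id ⊗ c` composed with the canonical identification `V ⊗ F ≃ V`. -/
def cRight (c : M →ₗ[F] F) : V ⊗[F] M →ₗ[F] V :=
  (TensorProduct.rid F V).toLinearMap ∘ₗ TensorProduct.map LinearMap.id c

/-- The transposition `T ⊗ Id` of the first two tensor factors of `V ⊗ (V ⊗ M)`. -/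
def Tfirst : V ⊗[F] (V ⊗[F] M) →ₗ[F] V ⊗[F] (V ⊗[F] M) :=
  (TensorProduct.assoc F V V M).toLinearMap ∘ₗ
    TensorProduct.map (TensorProduct.comm F V V).toLinearMap LinearMap.id ∘ₗ
    (TensorProduct.assoc F V V M).symm.toLinearMap

/-- The coefficient of `x₁^(-m-1) x₂^(-n-1)` in `(Id ⊗ Y(x₂)) Y(x₁)`. -/
def comp12 (ΔM : ℤ → M →ₗ[F] V ⊗[F] M) (m n : ℤ) : M →ₗ[F] V ⊗[F] (V ⊗[F] M) :=
  TensorProduct.map LinearMap.id (ΔM n) ∘ₗ ΔM m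

/-- The coefficient of `x₀^(-m-1) x₂^(-n-1)` in `(Y(x₀) ⊗ Id) Y(x₂)`. -/
def compR (ΔV : ℤ → V →ₗ[F] V ⊗[F] V) (ΔM : ℤ → M →ₗ[F] V ⊗[F] M) (m n : ℤ) :
    M →ₗ[F] V ⊗[F] (V ⊗[F] M) :=
  (TensorProduct.assoc F V V M).toLinearMap ∘ₗ TensorProduct.map (ΔV m) LinearMap.id ∘ₗ ΔM n

/-- The coefficient form of the (comodule) Jacobi identity of a vertex coalgebra,
obtained by extracting the coefficient of `x₀^(-a-1) x₁^(-b-1) x₂^(-c-1)`. -/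
def JacobiId (ΔV : ℤ → V →ₗ[F] V ⊗[F] V) (ΔM : ℤ → M →ₗ[F] V ⊗[F] M) : Prop :=
  ∀ (a b c : ℤ) (w : M),
    (∑ᶠ i : ℕ, ((-1 : F) ^ i * gchoose F a i) •
        (comp12 F ΔM (a + b - i) (c + i) w -
          (-1 : F) ^ a • Tfirst F (comp12 F ΔM (a + c - i) (b + i) w))) =
      ∑ᶠ i : ℕ, gchoose F b i • compR F ΔV ΔM (a + i) (b + c - i) w

/-- The axioms of a vertex coalgebra except the Jacobi identity: left counit,
cocreation and truncation, in coefficient form. -/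
def IsVertexCoalgSansJacobi (Δ : ℤ → V →ₗ[F] V ⊗[F] V) (c : V →ₗ[F] F) : Prop :=
  (∀ v : V, cLeft F c (Δ (-1) v) = v) ∧
  (∀ k : ℤ, k ≠ -1 → ∀ v : V, cLeft F c (Δ k v) = 0) ∧
  (∀ v : V, cRight F c (Δ (-1) v) = v) ∧
  (∀ k : ℤ, 0 ≤ k → ∀ v : V, cRight F c (Δ k v) = 0) ∧
  (∀ v : V, ∃ N : ℤ, ∀ k : ℤ, k < N → Δ k v = 0)

/-- The axioms of a vertex coalgebra. -/
def IsVertexCoalg (Δ : ℤ → V →ₗ[F] V ⊗[F] V) (c : V →ₗ[F] F) : Prop :=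
  IsVertexCoalgSansJacobi F Δ c ∧ JacobiId F Δ Δ

/-- The weight-`m` component of `V ⊗ V` for a graded space `V`. -/
def grT2 (gr : ℤ → Submodule F V) (m : ℤ) : Submodule F (V ⊗[F] V) :=
  ⨆ p : ℤ, LinearMap.range (TensorProduct.map (gr p).subtype (gr (m - p)).subtype)

/-- The weight-`m` component of `V ⊗ (V ⊗ V)` for a graded space `V`. -/
def grT3 (gr : ℤ → Submodule F V) (m : ℤ) : Submodule F (V ⊗[F] (V ⊗[F] V)) :=
  ⨆ p : ℤ × ℤ, LinearMap.range (TensorProduct.map (gr p.1).subtype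
    (TensorProduct.map (gr p.2).subtype (gr (m - p.1 - p.2)).subtype))

/-- The grading axioms of a graded vertex coalgebra: `V = ⊕ₖ V₍ₖ₎` internally,
`V₍ₖ₎ = 0` for `k` sufficiently small, and `Δ k` raises weight by `k + 1`. -/
def IsGradedVC (Δ : ℤ → V →ₗ[F] V ⊗[F] V) (gr : ℤ → Submodule F V) : Prop :=
  DirectSum.IsInternal gr ∧ (∃ N : ℤ, ∀ k : ℤ, k < N → gr k = ⊥) ∧
  (∀ r k : ℤ, ∀ v ∈ gr r, Δ k v ∈ grT2 F gr (r + k + 1))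

/-- `f` belongs to the graded dual `(V^{⊗3})'`: it vanishes on all but finitely
many homogeneous components of `V ⊗ V ⊗ V`. -/
def GradedDual3 (gr : ℤ → Submodule F V) (f : V ⊗[F] (V ⊗[F] V) →ₗ[F] F) : Prop :=
  ∃ s : Finset ℤ, ∀ m : ℤ, m ∉ s → ∀ u ∈ grT3 F gr m, f u = 0

/-- The weight-`q` component of `V ⊗ M` for `V` a `ℤ`-graded space and
`M` a `ℚ`-graded space. -/
def grVM (gr : ℤ → Submodule F V) (grM : ℚ → Submodule F M) (q : ℚ) :
    Submodule F (V ⊗[F] M) :=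
  ⨆ p : ℤ, LinearMap.range (TensorProduct.map (gr p).subtype (grM (q - p)).subtype)

/-- The weight-`q` component of `V ⊗ (V ⊗ M)`. -/
def grVVM (gr : ℤ → Submodule F V) (grM : ℚ → Submodule F M) (q : ℚ) :
    Submodule F (V ⊗[F] (V ⊗[F] M)) :=
  ⨆ p : ℤ × ℤ, LinearMap.range (TensorProduct.map (gr p.1).subtype
    (TensorProduct.map (gr p.2).subtype (grM (q - p.1 - p.2)).subtype))

/-- `f` belongs to the graded dual `(V ⊗ V ⊗ M)'`. -/
def GradedDualVVM (gr : ℤ → Submodule F V) (grM : ℚ → Submodule F M)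
    (f : V ⊗[F] (V ⊗[F] M) →ₗ[F] F) : Prop :=
  ∃ s : Finset ℚ, ∀ q : ℚ, q ∉ s → ∀ u ∈ grVVM F gr grM q, f u = 0

/-- The axioms of a comodule over a graded vertex coalgebra, except the Jacobi
identity: left counit, truncation, internal `ℚ`-grading bounded below, and the
grading condition on the comodule coproduct. -/
def IsComoduleSansJacobi (c : V →ₗ[F] F) (ΔM : ℤ → M →ₗ[F] V ⊗[F] M)
    (gr : ℤ → Submodule F V) (grM : ℚ → Submodule F M) : Prop :=
  (∀ w : M, cLeft F c (ΔM (-1) w) = w) ∧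
  (∀ k : ℤ, k ≠ -1 → ∀ w : M, cLeft F c (ΔM k w) = 0) ∧
  (∀ w : M, ∃ N : ℤ, ∀ k : ℤ, k < N → ΔM k w = 0) ∧
  DirectSum.IsInternal grM ∧ (∃ N : ℚ, ∀ q : ℚ, q < N → grM q = ⊥) ∧
  (∀ (j : ℚ) (k : ℤ), ∀ w ∈ grM j, ΔM k w ∈ grVM F gr grM (j + k + 1))

/-- Weak cocommutativity with exponent `k`, paired against `f`, coefficient-wise:
the coefficient of `x₁^(-b-1) x₂^(-c-1)` in
`(x₁-x₂)^k ⟨f, (Id ⊗ Y(x₂))Y(x₁)w - (T ⊗ Id)(Id ⊗ Y(x₁))Y(x₂)w⟩` vanishes. -/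
def WeakCocom (ΔM : ℤ → M →ₗ[F] V ⊗[F] M) (f : V ⊗[F] (V ⊗[F] M) →ₗ[F] F)
    (k : ℕ) : Prop :=
  ∀ (w : M) (b c : ℤ),
    ∑ j ∈ Finset.range (k + 1), ((-1 : F) ^ j * (k.choose j : F)) *
      (f (comp12 F ΔM (b + k - j) (c + j) w) -
        f (Tfirst F (comp12 F ΔM (c + j) (b + k - j) w))) = 0

/-- Weak coassociativity with exponent `k`, paired against `f`, coefficient-wise:
the coefficient of `x₀^(-a-1) x₂^(-c-1)` in
`(x₀+x₂)^k ⟨f, (Y(x₀) ⊗ Id)Y(x₂)w - (Id ⊗ Y(x₂))Y(x₀+x₂)w⟩` vanishes,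
`Y(x₀+x₂)` being expanded in nonnegative integral powers of `x₂`. -/
def WeakCoassoc (ΔV : ℤ → V →ₗ[F] V ⊗[F] V) (ΔM : ℤ → M →ₗ[F] V ⊗[F] M)
    (f : V ⊗[F] (V ⊗[F] M) →ₗ[F] F) (k : ℕ) : Prop :=
  ∀ (w : M) (a c : ℤ),
    ∑ j ∈ Finset.range (k + 1), (k.choose j : F) *
      (f (compR F ΔV ΔM (a + k - j) (c + j) w) -
        ∑ᶠ i : ℕ, ((-1 : F) ^ i * gchoose F (a + k - j) i) *
          f (comp12 F ΔM (a + k - j - i) (c + j + i) w)) = 0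

/-- The coefficient function of `x^r y^s (x + ε y)^t · A`, where `A : ℤ → ℤ → F`
is the coefficient function of a formal series (`A m n` is the coefficient of
`x^m y^n`). -/
def mulPoly (r s t : ℕ) (ε : F) (A : ℤ → ℤ → F) (m n : ℤ) : F :=
  ∑ j ∈ Finset.range (t + 1), (t.choose j : F) * ε ^ j *
    A (m - (r : ℤ) - ((t - j : ℕ) : ℤ)) (n - (s : ℤ) - (j : ℤ))

/-- `g` is the coefficient function of a polynomial in two variables. -/
def IsPolyCoeff (g : ℤ → ℤ → F) : Prop :=
  {p : ℤ × ℤ | g p.1 p.2 ≠ 0}.Finite ∧ ∀ m n : ℤ, m < 0 ∨ n < 0 → g m n = 0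

/-- The coefficient function of the polynomial `h(x₁ - x₂, x₂)` in the
variables `x₁, x₂`, given the coefficient function of `h = h(x₀, x₂)`. -/
def substC (h : ℤ → ℤ → F) (m n : ℤ) : F :=
  ∑ᶠ j : ℕ, ((-1 : F) ^ j * gchoose F (m + j) j) * h (m + j) (n - j)

/-- The coefficient form of the Jacobi identity of a vertex algebra (the
Borcherds identity). -/
def VAJacobi (mul : ℤ → V →ₗ[F] V →ₗ[F] V) : Prop :=
  ∀ (a b c : ℤ) (u v w : V),
    (∑ᶠ i : ℕ, ((-1 : F) ^ i * gchoose F a i) •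
        (mul (a + b - i) u (mul (c + i) v w) -
          (-1 : F) ^ a • mul (a + c - i) v (mul (b + i) u w))) =
      ∑ᶠ i : ℕ, gchoose F b i • mul (b + c - i) (mul (a + i) u v) w

/-- The axioms of a vertex algebra: truncation, vacuum, creation and the Jacobi
identity, in coefficient form (`mul n u v` is `u_n v`). -/
def IsVA (mul : ℤ → V →ₗ[F] V →ₗ[F] V) (one : V) : Prop :=
  (∀ u v : V, ∃ N : ℤ, ∀ n : ℤ, N < n → mul n u v = 0) ∧
  (∀ v : V, mul (-1) one v = v) ∧
  (∀ n : ℤ, n ≠ -1 → ∀ v : V, mul n one v = 0) ∧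
  (∀ v : V, mul (-1) v one = v) ∧
  (∀ n : ℤ, 0 ≤ n → ∀ v : V, mul n v one = 0) ∧
  VAJacobi F mul

/-- The graded dual `V' = ⊕ₖ V₍ₖ₎*`, realized as the submodule of the full dual
consisting of functionals vanishing on all but finitely many components. -/
def gradedDual (gr : ℤ → Submodule F V) : Submodule F (Module.Dual F V) where
  carrier := {φ | ∃ s : Finset ℤ, ∀ k ∉ s, ∀ u ∈ gr k, φ u = 0}
  zero_mem' := ⟨∅, by intro k _ u _; simp⟩
  add_mem' := by
    rintro a b ⟨s, hs⟩ ⟨t, ht⟩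
    refine ⟨s ∪ t, ?_⟩
    intro k hk u hu
    simp only [Finset.mem_union, not_or] at hk
    simp [LinearMap.add_apply, hs k hk.1 u hu, ht k hk.2 u hu]
  smul_mem' := by
    rintro r a ⟨s, hs⟩
    refine ⟨s, ?_⟩
    intro k hk u hu
    simp [LinearMap.smul_apply, hs k hk u hu]

/-- The weight-`k` component `V₍ₖ₎* ⊆ V'` of the graded dual: functionals
vanishing on every component of weight other than `k`. -/
def gradedDualPiece (gr : ℤ → Submodule F V) (k : ℤ) :
    Submodule F ↥(gradedDual F gr) where
  carrier := {φ | ∀ j : ℤ, j ≠ k → ∀ u ∈ gr j, (φ : Module.Dual F V) u = 0}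
  zero_mem' := by intro j _ u _; simp
  add_mem' := by
    intro a b ha hb j hj u hu
    simp [ha j hj u hu, hb j hj u hu]
  smul_mem' := by
    intro r a ha j hj u hu
    simp [ha j hj u hu]

/-- The natural pairing of `V' ⊗ V'` with `V ⊗ V`. -/
def pairVV (gr : ℤ → Submodule F V) :
    ↥(gradedDual F gr) ⊗[F] ↥(gradedDual F gr) →ₗ[F] Module.Dual F (V ⊗[F] V) :=
  TensorProduct.dualDistrib F V V ∘ₗ
    TensorProduct.map (gradedDual F gr).subtype (gradedDual F gr).subtype

/-- The covacuum map on the graded dual: evaluation at the vacuum. -/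
def covac (gr : ℤ → Submodule F V) (one : V) : ↥(gradedDual F gr) →ₗ[F] F :=
  LinearMap.applyₗ one ∘ₗ (gradedDual F gr).subtype

/-- A bilinear form `B` on `V` extended componentwise to `V ⊗ V`. -/
def formT2 (B : V →ₗ[F] V →ₗ[F] F) : V ⊗[F] V →ₗ[F] Module.Dual F (V ⊗[F] V) :=
  TensorProduct.dualDistrib F V V ∘ₗ TensorProduct.map B B

theorem gchoose_zero_right (a : ℤ) : gchoose F a 0 = 1 := by
  simp [gchoose]

theorem gchoose_succ_succ (a : ℤ) (i : ℕ) :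
    gchoose F (a + 1) (i + 1) = gchoose F a (i + 1) + gchoose F a i := by
  have hi : (Nat.factorial i : F) ≠ 0 := Nat.cast_ne_zero.2 (Nat.factorial_ne_zero i)
  have hi' : ((i : F) + 1) ≠ 0 := by exact_mod_cast Nat.succ_ne_zero i
  have hprod : ∏ j ∈ Finset.range i, (((a + 1 : ℤ) : F) - ((j + 1 : ℕ) : F)) =
      ∏ j ∈ Finset.range i, ((a : F) - (j : F)) :=
    Finset.prod_congr rfl fun j _ => by push_cast; ring
  simp only [gchoose]
  rw [Finset.prod_range_succ', Finset.prod_range_succ, hprod, Nat.factorial_succ]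
  push_cast
  field_simp
  ring

theorem gchoose_natCast (k i : ℕ) : gchoose F (k : ℤ) i = (k.choose i : F) := by
  induction k generalizing i with
  | zero =>
    cases i with
    | zero => simp [gchoose_zero_right]
    | succ i => simp [gchoose, Finset.prod_range_succ']
  | succ k ih =>
    cases i with
    | zero => simp [gchoose_zero_right]
    | succ i =>
      rw [Nat.cast_succ, gchoose_succ_succ, ih, ih, Nat.choose_succ_succ]
      push_cast
      ring

theorem finsum_nat_eq_sum_range {A : Type*} [AddCommMonoid A] (u : ℕ → A) (L : ℕ)
    (h : ∀ i, L ≤ i → u i = 0) : ∑ᶠ i, u i = ∑ i ∈ Finset.range L, u i := by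
  refine finsum_eq_sum_of_support_subset _ fun i hi => ?_
  simp only [Finset.coe_range, Set.mem_Iio]
  by_contra hL
  exact hi (h i (not_lt.1 hL))

/-- The expansion of `(x₀ + x₂)^k A(x₀ + x₂, x₂)` in nonnegative powers of `x₂`, coefficient-wise,
for a series `A(x₁, x₂)` with coefficients `B` truncated in `x₁`. -/
theorem sum_choose_mul_finsum_gchoose (B : ℤ → ℤ → F) (N : ℤ)
    (hB : ∀ m n, m < N → B m n = 0) (k : ℕ) (a c : ℤ) :
    ∑ j ∈ Finset.range (k + 1), (k.choose j : F) *
        ∑ᶠ i : ℕ, ((-1 : F) ^ i * gchoose F (a + k - j) i) * B (a + k - j - i) (c + j + i) =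
      ∑ᶠ i : ℕ, ((-1 : F) ^ i * gchoose F a i) * B (a + k - i) (c + i) := by
  induction k generalizing a c with
  | zero => simp
  | succ k ih =>
    have key : ∑ᶠ i : ℕ, ((-1 : F) ^ i * gchoose F a i) * B (a + (k + 1 : ℕ) - i) (c + i) =
        ∑ᶠ i : ℕ, ((-1 : F) ^ i * gchoose F (a + 1) i) * B (a + 1 + k - i) (c + i) +
        ∑ᶠ i : ℕ, ((-1 : F) ^ i * gchoose F a i) * B (a + k - i) (c + 1 + i) := by
      obtain ⟨L, hL⟩ : ∃ L : ℕ, a + k + 1 - N < L := exists_nat_gt _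
      rw [finsum_nat_eq_sum_range _ (L + 1), finsum_nat_eq_sum_range _ (L + 1),
        finsum_nat_eq_sum_range _ L, Finset.sum_range_succ', Finset.sum_range_succ',
        add_right_comm, ← Finset.sum_add_distrib]
      · congr 1
        · refine Finset.sum_congr rfl fun i _ => ?_
          rw [gchoose_succ_succ,
            show a + ((k + 1 : ℕ) : ℤ) - ((i + 1 : ℕ) : ℤ) = a + k - i by push_cast; ring,
            show a + 1 + (k : ℤ) - ((i + 1 : ℕ) : ℤ) = a + k - i by push_cast; ring,
            show c + ((i + 1 : ℕ) : ℤ) = c + 1 + i by push_cast; ring]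
          ring
        · rw [gchoose_zero_right, gchoose_zero_right]
          push_cast
          ring_nf
      all_goals
        intro i hi
        rw [hB _ _ (by push_cast; omega), mul_zero]
    rw [key, ← ih, ← ih]
    have := Finset.sum_choose_succ_mul (R := F) (fun j _ => ∑ᶠ i : ℕ,
      ((-1 : F) ^ i * gchoose F (a + (k + 1 : ℕ) - j) i) *
        B (a + (k + 1 : ℕ) - j - i) (c + j + i)) k
    rw [this]
    congr 1 <;> refine Finset.sum_congr rfl fun j _ => ?_
    · rw [show a + ((k + 1 : ℕ) : ℤ) - j = a + 1 + k - j by push_cast; ring]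
    · rw [show a + ((k + 1 : ℕ) : ℤ) - ((j + 1 : ℕ) : ℤ) = a + k - j by push_cast; ring,
        show c + ((j + 1 : ℕ) : ℤ) = c + 1 + j by push_cast; ring]

omit [CharZero F] in
theorem grVM_eq_bot (gr : ℤ → Submodule F V) (grM : ℚ → Submodule F M) (N : ℤ) (N' : ℚ)
    (hN : ∀ k, k < N → gr k = ⊥) (hN' : ∀ q, q < N' → grM q = ⊥) (q : ℚ) (hq : q < N + N') :
    grVM F gr grM q = ⊥ := by
  refine iSup_eq_bot.2 fun p => ?_
  rw [LinearMap.range_eq_bot]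
  refine TensorProduct.ext' fun v m => ?_
  rcases lt_or_ge p N with hp | hp
  · have hv : (v : V) = 0 := by simpa [hN p hp] using v.2
    simp [hv]
  · have hp' : (N : ℚ) ≤ p := by exact_mod_cast hp
    have hm : (m : M) = 0 := by simpa [hN' (q - p) (by linarith)] using m.2
    simp [hm]

omit [CharZero F] in
theorem tmul_mem_grVVM (gr : ℤ → Submodule F V) (grM : ℚ → Submodule F M) (p p' : ℤ) (q : ℚ)
    {v v' : V} {m : M} (hv : v ∈ gr p) (hv' : v' ∈ gr p') (hm : m ∈ grM (q - p - p')) :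
    v ⊗ₜ[F] (v' ⊗ₜ[F] m) ∈ grVVM F gr grM q :=
  Submodule.mem_iSup_of_mem (p, p')
    ⟨(⟨v, hv⟩ : gr p) ⊗ₜ[F] ((⟨v', hv'⟩ : gr p') ⊗ₜ[F] (⟨m, hm⟩ : grM (q - p - p'))), rfl⟩

omit [CharZero F] in
theorem Tfirst_mem_grVVM (gr : ℤ → Submodule F V) (grM : ℚ → Submodule F M) (q : ℚ)
    {u : V ⊗[F] (V ⊗[F] M)} (hu : u ∈ grVVM F gr grM q) :
    Tfirst F u ∈ grVVM F gr grM q := by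
  suffices h : grVVM F gr grM q ≤ (grVVM F gr grM q).comap (Tfirst F) from h hu
  refine iSup_le fun p => ?_
  rintro _ ⟨t, rfl⟩
  induction t with
  | zero => simp
  | add x y hx hy => rw [map_add]; exact add_mem hx hy
  | tmul v t =>
    induction t with
    | zero => simp
    | add x y hx hy => rw [TensorProduct.tmul_add, map_add]; exact add_mem hx hy
    | tmul v' m =>
      exact tmul_mem_grVVM F gr grM p.2 p.1 q v'.2 v.2 (by rw [sub_right_comm]; exact m.2)

omit [CharZero F] in
theorem comp12_mem_grVVM (ΔM : ℤ → M →ₗ[F] V ⊗[F] M) (gr : ℤ → Submodule F V)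
    (grM : ℚ → Submodule F M)
    (hΔ : ∀ (j : ℚ) (k : ℤ), ∀ w ∈ grM j, ΔM k w ∈ grVM F gr grM (j + k + 1))
    (j : ℚ) (m n : ℤ) {w : M} (hw : w ∈ grM j) :
    comp12 F ΔM m n w ∈ grVVM F gr grM (j + m + n + 2) := by
  suffices h : grVM F gr grM (j + m + 1) ≤ (grVVM F gr grM (j + m + n + 2)).comap
      (TensorProduct.map LinearMap.id (ΔM n)) from h (hΔ j m w hw)
  refine iSup_le fun p => ?_
  rintro _ ⟨t, rfl⟩
  induction t with
  | zero => simp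
  | add x y hx hy => rw [map_add]; exact add_mem hx hy
  | tmul v x =>
    suffices h : grVM F gr grM (j + m + 1 - p + n + 1) ≤ (grVVM F gr grM (j + m + n + 2)).comap
        (TensorProduct.mk F V (V ⊗[F] M) v) from h (hΔ _ n x x.2)
    refine iSup_le fun p' => ?_
    rintro _ ⟨t, rfl⟩
    induction t with
    | zero => simp
    | add x y hx hy => rw [map_add]; exact add_mem hx hy
    | tmul v' y =>
      refine tmul_mem_grVVM F gr grM p p' _ v.2 v'.2 ?_
      rw [show j + m + n + 2 - p - p' = j + m + 1 - p + n + 1 - p' by ring]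
      exact y.2

omit [CharZero F] in
/-- A functional in the graded dual annihilates the transposed iterates whose second index is
large, since weights are bounded below. -/
theorem exists_forall_Tfirst_comp12_eq_zero (gr : ℤ → Submodule F V)
    (ΔM : ℤ → M →ₗ[F] V ⊗[F] M) (grM : ℚ → Submodule F M)
    (hgr : ∃ N : ℤ, ∀ k : ℤ, k < N → gr k = ⊥) (hM : DirectSum.IsInternal grM)
    (hgrM : ∃ N : ℚ, ∀ q : ℚ, q < N → grM q = ⊥)
    (hΔ : ∀ (j : ℚ) (k : ℤ), ∀ w ∈ grM j, ΔM k w ∈ grVM F gr grM (j + k + 1))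
    (f : V ⊗[F] (V ⊗[F] M) →ₗ[F] F) (hf : GradedDualVVM F gr grM f) :
    ∃ k : ℕ, 0 < k ∧ ∀ (m n : ℤ) (w : M), (k : ℤ) ≤ n → f (Tfirst F (comp12 F ΔM m n w)) = 0 := by
  obtain ⟨N, hN⟩ := hgr
  obtain ⟨N', hN'⟩ := hgrM
  obtain ⟨s, hs⟩ := hf
  obtain ⟨S, hS⟩ := s.bddAbove
  obtain ⟨k, hk⟩ := exists_nat_gt (S - N - N')
  refine ⟨k + 1, k.succ_pos, fun m n w hn => ?_⟩
  suffices h : (⊤ : Submodule F M) ≤ LinearMap.ker (f ∘ₗ Tfirst F ∘ₗ comp12 F ΔM m n) from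
    h Submodule.mem_top
  rw [← hM.submodule_iSup_eq_top]
  refine iSup_le fun j w hw => ?_
  change f (Tfirst F (comp12 F ΔM m n w)) = 0
  by_cases hq : j + m + n + 2 ∈ s
  · have hle : j + m + n + 2 ≤ S := hS hq
    have hn' : (k : ℚ) + 1 ≤ n := by exact_mod_cast hn
    have h0 : ΔM m w = 0 := by
      have := hΔ j m w hw
      rwa [grVM_eq_bot F gr grM N N' hN hN' _ (by linarith), Submodule.mem_bot] at this
    simp [comp12, h0]
  · exact hs _ hq _ (Tfirst_mem_grVVM F gr grM _ (comp12_mem_grVVM F ΔM gr grM hΔ j m n hw))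

/-- Weak coassociativity for comodules: Let `M` be a comodule
over a graded vertex coalgebra `(V, Y_V, c)`.  For every `v' ∈ (V ⊗ V ⊗ M)'`
there exists `k ∈ ℤ₊`, depending only on `v'`, such that for every `w ∈ M`,
`(x₀+x₂)^k ⟨v', (Y_V(x₀) ⊗ Id)Y_M(x₂)w - (Id ⊗ Y_M(x₂))Y_M(x₀+x₂)w⟩ = 0`,
`Y_M(x₀+x₂)` being expanded in nonnegative integral powers of `x₂`. -/
theorem comodule_weak_coassociativity
    (ΔV : ℤ → V →ₗ[F] V ⊗[F] V) (c : V →ₗ[F] F) (gr : ℤ → Submodule F V)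
    (hVC : IsVertexCoalg F ΔV c) (hgr : IsGradedVC F ΔV gr)
    (ΔM : ℤ → M →ₗ[F] V ⊗[F] M) (grM : ℚ → Submodule F M)
    (hmod : IsComoduleSansJacobi F c ΔM gr grM)
    (hJac : JacobiId F ΔV ΔM)
    (f : V ⊗[F] (V ⊗[F] M) →ₗ[F] F) (hf : GradedDualVVM F gr grM f) :
    ∃ k : ℕ, 0 < k ∧ WeakCoassoc F ΔV ΔM f k := by
  obtain ⟨-, -, htr, hM, hgrM, hΔ⟩ := hmod
  obtain ⟨k, hk, hT⟩ :=
    exists_forall_Tfirst_comp12_eq_zero F gr ΔM grM hgr.2.1 hM hgrM hΔ f hf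
  refine ⟨k, hk, fun w a c => ?_⟩
  obtain ⟨N, hN⟩ := htr w
  have hcomp : ∀ m n, m < N → comp12 F ΔM m n w = 0 := fun m n hm => by
    simp [comp12, hN m hm]
  have hJ := congrArg f (hJac a k c w)
  obtain ⟨L, hL⟩ : ∃ L : ℕ, max (a + k - N) (a + c - N) < L := exists_nat_gt _
  rw [max_lt_iff] at hL
  rw [finsum_nat_eq_sum_range _ L fun i hi => by
      rw [hcomp _ _ (by omega), hcomp _ _ (by omega)]; simp,
    finsum_nat_eq_sum_range _ (k + 1) fun i hi => by
      rw [gchoose_natCast, Nat.choose_eq_zero_of_lt hi]; simp] at hJ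
  simp only [map_sum, map_smul, map_sub, smul_eq_mul, gchoose_natCast] at hJ
  simp only [mul_sub, Finset.sum_sub_distrib]
  rw [sum_choose_mul_finsum_gchoose F (fun m n => f (comp12 F ΔM m n w)) N
      (fun m n hm => by simp [hcomp m n hm]),
    finsum_nat_eq_sum_range _ L fun i hi => by simp [hcomp (a + k - i) (c + i) (by omega)],
    sub_eq_zero, ← Finset.sum_range_reflect]
  refine Eq.trans ?_ (hJ.symm.trans ?_)
  · refine Finset.sum_congr rfl fun j hj => ?_
    have hj' : j ≤ k := Nat.lt_succ_iff.1 (Finset.mem_range.1 hj)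
    rw [Nat.add_sub_cancel, Nat.choose_symm hj', Nat.cast_sub hj',
      show a + k - ((k : ℤ) - j) = a + j by ring, show c + ((k : ℤ) - j) = k + c - j by ring]
  · refine Finset.sum_congr rfl fun i _ => ?_
    rw [hT _ _ _ (by omega), mul_zero, sub_zero]
end
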